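/- arXiv:1203.1187 — 4 statements merged into one kernel-verified Lean document; each statement's English description precedes it below -/
import Mathlib

section
/- Let $p$ be an odd prime, let $\Xi \in \mathbb{F}_p$ be a quadratic non-residue, and let $H$ be a subgroup of $\mathbb{F}_p^{\times}$ of index $d = [\mathbb{F}_p^{\times} : H]$. Then for every $a \in \mathbb{F}_p^{\times}$, the set $\{(x,y) \in \mathbb{F}_p^2 : x^2 - \Xi^{-1} y^2 \in aH\}$ has exactly $(p^2-1)/d$ elements. -/
lemma aux_zero {p : ℕ} [Fact p.Prime] (c : ZMod p) (hc : ¬ ∃ z : ZMod p, z ^ 2 = c)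
    (x y : ZMod p) (h : x ^ 2 - c * y ^ 2 = 0) : x = 0 ∧ y = 0 := by
  by_cases hy : y = 0
  · subst hy
    simp at h
    exact ⟨h, rfl⟩
  · exfalso
    apply hc
    refine ⟨x / y, ?_⟩
    field_simp
    linear_combination h

lemma aux_surj {p : ℕ} [Fact p.Prime] (hp : Odd p) (c : ZMod p) (hc : c ≠ 0)
    (u : ZMod p) : ∃ x y : ZMod p, x ^ 2 - c * y ^ 2 = u := by
  classical
  have h1 : (Polynomial.X ^ 2 - Polynomial.C u : Polynomial (ZMod p)).degree = 2 :=
    Polynomial.degree_X_pow_sub_C (by norm_num) _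
  have h2 : (Polynomial.C (-c) * Polynomial.X ^ 2 : Polynomial (ZMod p)).degree = 2 :=
    Polynomial.degree_C_mul_X_pow 2 (neg_ne_zero.mpr hc)
  obtain ⟨x, y, h⟩ := FiniteField.exists_root_sum_quadratic h1 h2
    (by rw [ZMod.card]; exact Nat.odd_iff.mp hp)
  refine ⟨x, y, ?_⟩
  simp at h
  linear_combination h

open Classical in
lemma aux_le {p : ℕ} [Fact p.Prime] (hp : Odd p) (c : ZMod p) (hc : c ≠ 0)
    (u v : ZMod p) (hu : u ≠ 0) (hv : v ≠ 0) :
    (Finset.univ.filter (fun q : ZMod p × ZMod p => q.1 ^ 2 - c * q.2 ^ 2 = u)).card ≤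
    (Finset.univ.filter (fun q : ZMod p × ZMod p => q.1 ^ 2 - c * q.2 ^ 2 = v)).card := by
  obtain ⟨s, t, hst⟩ := aux_surj hp c hc (v / u)
  have hw : s ^ 2 - c * t ^ 2 ≠ 0 := by rw [hst]; exact div_ne_zero hv hu
  apply Finset.card_le_card_of_injOn (fun q => (s * q.1 + c * t * q.2, s * q.2 + t * q.1))
  · intro q hq
    simp only [Finset.coe_filter, Finset.mem_univ, true_and, Set.mem_setOf_eq] at hq ⊢
    have : v = (s ^ 2 - c * t ^ 2) * (q.1 ^ 2 - c * q.2 ^ 2) := by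
      rw [hst, hq]; field_simp
    rw [this]; ring
  · rintro ⟨x, y⟩ - ⟨x', y'⟩ - h
    simp only [Prod.mk.injEq] at h
    obtain ⟨h1, h2⟩ := h
    ext
    · apply mul_left_cancel₀ hw
      linear_combination s * h1 - c * t * h2
    · apply mul_left_cancel₀ hw
      linear_combination s * h2 - t * h1

/-- Let `p` be an odd prime, `Ξ ∈ 𝔽_p` a quadratic non-residue, and `H` a subgroup of
`𝔽_p^×` of index `d`. Then for every `a ∈ 𝔽_p^×`, the set
`{(x, y) ∈ 𝔽_p² : x² - Ξ⁻¹ y² ∈ aH}` has exactly `(p² - 1)/d` elements. -/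
theorem card_coset_conic (p : ℕ) (hp : p.Prime) (hodd : Odd p)
    (Ξ : ZMod p) (hΞ : ¬ ∃ z : ZMod p, z ^ 2 = Ξ)
    (H : Subgroup (ZMod p)ˣ) (d : ℕ) (hd : d = H.index)
    (a : (ZMod p)ˣ) :
    {xy : ZMod p × ZMod p |
      ∃ h ∈ H, ((a * h : (ZMod p)ˣ) : ZMod p) = xy.1 ^ 2 - Ξ⁻¹ * xy.2 ^ 2}.ncard
      = (p ^ 2 - 1) / d := by
  classical
  haveI : Fact p.Prime := ⟨hp⟩
  have hc : ¬ ∃ z : ZMod p, z ^ 2 = Ξ⁻¹ := by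
    rintro ⟨z, hz⟩
    exact hΞ ⟨z⁻¹, by rw [inv_pow, hz, inv_inv]⟩
  generalize Ξ⁻¹ = c at hc ⊢
  have hc0 : c ≠ 0 := by
    rintro rfl
    exact hc ⟨0, by simp⟩
  set f : ZMod p × ZMod p → ZMod p := fun q => q.1 ^ 2 - c * q.2 ^ 2 with hf
  set N := (Finset.univ.filter (fun q => f q = 1)).card with hN
  have hfib : ∀ u : ZMod p, u ≠ 0 → (Finset.univ.filter (fun q => f q = u)).card = N :=
    fun u hu => le_antisymm (aux_le hodd c hc0 u 1 hu one_ne_zero)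
      (aux_le hodd c hc0 1 u one_ne_zero hu)
  have key : ∀ T : Finset (ZMod p), (0 : ZMod p) ∉ T →
      (Finset.univ.filter (fun q => f q ∈ T)).card = T.card * N := by
    intro T hT
    rw [Finset.card_eq_sum_card_fiberwise (f := f) (t := T) (by intro q hq; simpa using hq)]
    rw [Finset.sum_const_nat (m := N)]
    intro u hu
    rw [← hfib u (by rintro rfl; exact hT hu)]
    congr 1
    ext q
    simp only [Finset.mem_filter, Finset.mem_univ, true_and, and_iff_right_iff_imp]
    rintro rfl
    exact hu
  have htot : p ^ 2 - 1 = (p - 1) * N := by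
    have h := key (Finset.univ.erase 0) (by simp)
    rw [Finset.card_erase_of_mem (Finset.mem_univ _), Finset.card_univ, ZMod.card] at h
    rw [← h]
    have : (Finset.univ.filter (fun q => f q ∈ Finset.univ.erase (0 : ZMod p)))
        = Finset.univ.erase ((0, 0) : ZMod p × ZMod p) := by
      ext ⟨x, y⟩
      simp only [Finset.mem_filter, Finset.mem_univ, true_and, Finset.mem_erase, and_true, ne_eq,
        Prod.mk.injEq]
      refine not_congr ⟨aux_zero c hc x y, ?_⟩
      rintro ⟨rfl, rfl⟩
      simp [hf]
    rw [this, Finset.card_erase_of_mem (Finset.mem_univ _), Finset.card_univ, Fintype.card_prod,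
      ZMod.card, sq]
  set T : Finset (ZMod p) := (Finset.univ.filter (fun h => h ∈ H)).image
    (fun h => ((a * h : (ZMod p)ˣ) : ZMod p)) with hT
  have hTc : T.card = Nat.card H := by
    rw [hT, Finset.card_image_of_injective, Nat.card_eq_fintype_card, Fintype.card_subtype]
    intro x y hxy
    exact mul_left_cancel (Units.ext hxy)
  have hT0 : (0 : ZMod p) ∉ T := by
    intro h
    simp [hT] at h
  have hset : {xy : ZMod p × ZMod p |
      ∃ h ∈ H, ((a * h : (ZMod p)ˣ) : ZMod p) = xy.1 ^ 2 - c * xy.2 ^ 2}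
      = ((Finset.univ.filter (fun q => f q ∈ T) : Finset (ZMod p × ZMod p)) : Set _) := by
    ext q
    simp [hT, hf]
  have hmul : Nat.card H * d = p - 1 := by
    rw [hd, H.card_mul_index, Nat.card_eq_fintype_card, ZMod.card_units]
  have hd0 : 0 < d := by
    rw [hd]; exact Nat.pos_of_ne_zero H.index_ne_zero_of_finite
  rw [hset, Set.ncard_coe_finset, key T hT0, hTc, htot, ← hmul]
  symm
  apply Nat.div_eq_of_eq_mul_right hd0
  ring
end

section
/- Let $p$ be a prime and let $\mathcal{A}$ be the set of pairs $(a_1, a_2)$ with $a_1, a_2 \in \{0, 1/p, 2/p, \dots, (p-1)/p\}$ and $(a_1, a_2) \neq (0,0)$. Then for every $\tau$ in the upper half-plane, $\prod_{\mathbf{a} \in \mathcal{A}} g_{\mathbf{a}}(\tau)^{12p} = p^{12p}$. -/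
open Complex

/-- The Siegel function `g_𝐚` for `𝐚 = (a₁, a₂)`, defined on the upper half-plane by
`g_𝐚(τ) = -q_τ^{B₂(a₁)/2} e^{π i a₂(a₁-1)} ∏_{n≥0} (1 - q_τ^{n+a₁} e^{2π i a₂})(1 - q_τ^{n+1-a₁} e^{-2π i a₂})`,
where `q_τ^s := e^{2π i s τ}` and `B₂(T) = T² - T + 1/6`. -/
noncomputable def siegelFunction (a₁ a₂ : ℝ) (τ : ℂ) : ℂ :=
  -Complex.exp (2 * Real.pi * I * (((a₁ : ℂ) ^ 2 - a₁ + 1 / 6) / 2) * τ)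
    * Complex.exp (Real.pi * I * a₂ * ((a₁ : ℂ) - 1))
    * ∏' n : ℕ,
        ((1 - Complex.exp (2 * Real.pi * I * (((n : ℂ) + a₁)) * τ)
            * Complex.exp (2 * Real.pi * I * a₂))
          * (1 - Complex.exp (2 * Real.pi * I * (((n : ℂ) + 1 - a₁)) * τ)
            * Complex.exp (-(2 * Real.pi * I) * a₂)))

lemma sg_root (k : ℕ) (z y : ℂ) (hz : IsPrimitiveRoot z (k+1)) :
    ∏ s ∈ Finset.range (k+1), (1 - y * z ^ s) = 1 - y ^ (k+1) := by
  have h := X_pow_sub_C_eq_prod hz (Nat.succ_pos k) (rfl : y ^ (k+1) = y ^ (k+1))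
  have h2 := congrArg (Polynomial.eval 1) h
  simp only [Polynomial.eval_sub, Polynomial.eval_pow, Polynomial.eval_X, Polynomial.eval_C,
    Polynomial.eval_prod, one_pow] at h2
  rw [h2]
  exact Finset.prod_congr rfl fun s _ => by ring

lemma sg_all (k : ℕ) (z : ℂ) (hz : IsPrimitiveRoot z (k+1)) (y : ℕ → ℂ) :
    (1 - y 0) * ∏ a ∈ (Finset.range (k+1) ×ˢ Finset.range (k+1)).erase (0, 0),
      (1 - y a.1 * z ^ a.2) = ∏ r ∈ Finset.range (k+1), (1 - (y r) ^ (k+1)) := by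
  have h := Finset.mul_prod_erase (Finset.range (k+1) ×ˢ Finset.range (k+1))
    (fun a : ℕ × ℕ => 1 - y a.1 * z ^ a.2) (a := (0,0)) (by simp)
  simp only [pow_zero, mul_one] at h
  rw [h, Finset.prod_product]
  exact Finset.prod_congr rfl fun r _ => sg_root k z (y r) hz

lemma sg_erase {M : Type*} [CommMonoid M] (k : ℕ) (f : ℕ × ℕ → M) :
    ∏ a ∈ (Finset.range (k+1) ×ˢ Finset.range (k+1)).erase (0, 0), f a
     = (∏ s ∈ Finset.range k, f (0, s+1)) *
       ∏ r ∈ Finset.range k, ∏ s ∈ Finset.range (k+1), f (r+1, s) := by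
  have e : (Finset.range (k+1) ×ˢ Finset.range (k+1)).erase (0, 0)
    = ((Finset.range k).image (fun s => ((0, s+1) : ℕ × ℕ))) ∪
      ((Finset.range k ×ˢ Finset.range (k+1)).image (fun a => ((a.1+1, a.2) : ℕ × ℕ))) := by
    ext ⟨r, s⟩
    simp only [Finset.mem_erase, Finset.mem_product, Finset.mem_range, Finset.mem_union,
      Finset.mem_image, Prod.mk.injEq, ne_eq, Prod.exists]
    constructor
    · rintro ⟨h1, h2, h3⟩
      rcases r with _ | r
      · left; exact ⟨s - 1, by omega, rfl, by omega⟩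
      · right; exact ⟨r, s, by omega, rfl, rfl⟩
    · rintro (⟨a, h1, h2, h3⟩ | ⟨a, b, h1, h2, h3⟩) <;> omega
  rw [e, Finset.prod_union, Finset.prod_image, Finset.prod_image, Finset.prod_product]
  · rintro ⟨a, b⟩ _ ⟨c, d⟩ _ h; simp at h ⊢; exact h
  · intro a _ b _ h; simpa using h
  · rw [Finset.disjoint_left]
    intro x h1 h2
    simp only [Finset.mem_image] at h1 h2
    obtain ⟨a, _, rfl⟩ := h1
    obtain ⟨b, _, h⟩ := h2
    simp at h

lemma sg_mult (q c : ℂ) (hq : ‖q‖ < 1) : Multipliable fun n : ℕ => 1 - c * q ^ n := by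
  simp_rw [sub_eq_add_neg]
  apply multipliable_one_add_of_summable
  simpa using (summable_geometric_of_lt_one (norm_nonneg _) hq).mul_left ‖c‖

lemma sg_ne (q : ℂ) (hq : ‖q‖ < 1) : ∏' n : ℕ, (1 - q ^ (n+1)) ≠ 0 := by
  simp_rw [sub_eq_add_neg]
  apply tprod_one_add_ne_zero_of_summable
  · intro i h
    have : q ^ (i+1) = 1 := by linear_combination -h
    have h2 := congrArg norm this
    rw [norm_pow, norm_one] at h2
    exact absurd h2 (pow_lt_one₀ (norm_nonneg _) hq (by omega)).ne
  · simpa using (summable_nat_add_iff 1).mpr (summable_geometric_of_lt_one (norm_nonneg _) hq)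

lemma sg_core (k : ℕ) (x z : ℂ) (hx : ‖x‖ < 1) (hz : IsPrimitiveRoot z (k+1)) :
    ∏ a ∈ (Finset.range (k+1) ×ˢ Finset.range (k+1)).erase (0, 0),
      ∏' n : ℕ, ((1 - x ^ ((k+1) * n + a.1) * z ^ a.2)
        * (1 - x ^ ((k+1) * n + (k + 1 - a.1)) * (z⁻¹) ^ a.2)) = (k : ℂ) + 1 := by
  set A := (Finset.range (k+1) ×ˢ Finset.range (k+1)).erase (0, 0) with hA
  set q := x ^ (k+1) with hqd
  have hq : ‖q‖ < 1 := by
    rw [hqd, norm_pow]; exact pow_lt_one₀ (norm_nonneg _) hx (by omega)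
  set P : ℕ → ℂ := fun M => ∏ m ∈ Finset.range M, (1 - q ^ (m+1)) with hP
  have hadd : ∀ M N, P (M + N) = P M * ∏ r ∈ Finset.range N, (1 - q ^ (M + r + 1)) :=
    fun M N => Finset.prod_range_add _ _ _
  have hPl : Filter.Tendsto P Filter.atTop (nhds (∏' n : ℕ, (1 - q ^ (n+1)))) :=
    (ModularForm.multipliable_one_sub_pow hq).hasProd.tendsto_prod_nat
  have hL := sg_ne q hq
  have mu : ∀ a : ℕ × ℕ, Multipliable fun n : ℕ => (1 - x ^ ((k+1) * n + a.1) * z ^ a.2) := by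
    intro a
    refine (sg_mult q (x ^ a.1 * z ^ a.2) hq).congr fun n => ?_
    rw [pow_add, pow_mul]; ring
  have mv : ∀ a : ℕ × ℕ, Multipliable fun n : ℕ =>
      (1 - x ^ ((k+1) * n + (k + 1 - a.1)) * (z⁻¹) ^ a.2) := by
    intro a
    refine (sg_mult q (x ^ (k + 1 - a.1) * (z⁻¹) ^ a.2) hq).congr fun n => ?_
    rw [pow_add, pow_mul]; ring
  have hz' : IsPrimitiveRoot z⁻¹ (k+1) := hz.inv
  have tU := (hasProd_prod (s := A) fun a _ => (mu a).hasProd).tendsto_prod_nat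
  have tV := (hasProd_prod (s := A) fun a _ => (mv a).hasProd).tendsto_prod_nat
  set U : ℕ → ℂ := fun n => ∏ a ∈ A, (1 - x ^ ((k+1) * n + a.1) * z ^ a.2) with hU
  set V : ℕ → ℂ := fun n => ∏ a ∈ A,
      (1 - x ^ ((k+1) * n + (k + 1 - a.1)) * (z⁻¹) ^ a.2) with hV
  have sU : ∀ n, (1 - q ^ n) * U n = ∏ r ∈ Finset.range (k+1), (1 - q ^ ((k+1) * n + r)) := by
    intro n
    have h := sg_all k z hz (fun r => x ^ ((k+1) * n + r))
    rw [hqd, ← pow_mul]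
    refine h.trans (Finset.prod_congr rfl fun r _ => ?_)
    rw [← pow_mul, ← pow_mul, mul_comm]
  have sV : ∀ n, (1 - q ^ (n+1)) * V n =
      ∏ r ∈ Finset.range (k+1), (1 - q ^ ((k+1) * n + r + 1)) := by
    intro n
    have h := sg_all k z⁻¹ hz' (fun r => x ^ ((k+1) * n + (k + 1 - r)))
    rw [hqd, ← pow_mul, mul_add, mul_one]
    refine h.trans ?_
    rw [← Finset.prod_range_reflect]
    refine Finset.prod_congr rfl fun r hr => ?_
    have hr := Finset.mem_range.1 hr
    rw [← pow_mul, ← pow_mul, mul_comm]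
    congr 3
    omega
  have U0 : U 0 = (k + 1) * P k := by
    simp only [hU, mul_zero, zero_add]
    rw [hA, sg_erase]
    congr 1
    · simpa using hz.prod_one_sub_pow_eq_order
    · refine Finset.prod_congr rfl fun r _ => ?_
      refine (sg_root k z (x ^ (r+1)) hz).trans ?_
      rw [← pow_mul, ← pow_mul, mul_comm]
  have pU : ∀ N, (∏ n ∈ Finset.range (N+1), U n) * P N = (k+1) * P ((k+1) * N + k) := by
    intro N
    induction N with
    | zero => simp [U0, hP]
    | succ N ih =>
      have e : (k+1) * (N+1) + k = ((k+1)*N + k) + (k+1) := by ring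
      have h1 : P (N+1) = P N * (1 - q ^ (N+1)) := Finset.prod_range_succ _ _
      rw [h1, e, hadd, Finset.prod_range_succ, ← mul_assoc ((k : ℂ) + 1), ← ih]
      have h2 := sU (N+1)
      have h3 : ∏ r ∈ Finset.range (k+1), (1 - q ^ ((k+1) * (N+1) + r)) =
        ∏ r ∈ Finset.range (k+1), (1 - q ^ ((k+1) * N + k + r + 1)) :=
        Finset.prod_congr rfl fun r _ => by congr 2; ring
      rw [← h3, ← h2]; ring
  have pV : ∀ N, (∏ n ∈ Finset.range N, V n) * P N = P ((k+1) * N) := by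
    intro N
    induction N with
    | zero => simp [hP]
    | succ N ih =>
      have h1 : P (N+1) = P N * (1 - q ^ (N+1)) := Finset.prod_range_succ _ _
      rw [h1, mul_add, mul_one, hadd, Finset.prod_range_succ, ← ih, ← sV]; ring
  have EU : ∏ a ∈ A, ∏' n : ℕ, (1 - x ^ ((k+1) * n + a.1) * z ^ a.2) = k + 1 := by
    have t1 := ((Filter.tendsto_add_atTop_iff_nat 1).2 tU).mul hPl
    have t2 : Filter.Tendsto (fun N => ((k : ℂ)+1) * P ((k+1) * N + k)) Filter.atTop
        (nhds (((k : ℂ)+1) * ∏' n : ℕ, (1 - q ^ (n+1)))) := by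
      refine (hPl.comp (Filter.tendsto_atTop_mono (fun N => ?_) Filter.tendsto_id)).const_mul _
      simp only [id]; nlinarith
    have t3 := tendsto_nhds_unique (t1.congr pU) t2
    exact mul_right_cancel₀ hL t3
  have EV : ∏ a ∈ A, ∏' n : ℕ, (1 - x ^ ((k+1) * n + (k + 1 - a.1)) * (z⁻¹) ^ a.2) = 1 := by
    have t1 := tV.mul hPl
    have t2 : Filter.Tendsto (fun N => P ((k+1) * N)) Filter.atTop
        (nhds (∏' n : ℕ, (1 - q ^ (n+1)))) := by
      refine (hPl.comp (Filter.tendsto_atTop_mono (fun N => ?_) Filter.tendsto_id))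
      simp only [id]; nlinarith
    have t3 := tendsto_nhds_unique (t1.congr pV) t2
    exact mul_right_cancel₀ hL (t3.trans (one_mul _).symm)
  have fin := Finset.prod_congr (rfl : A = A) fun a _ => (mu a).tprod_mul (mv a)
  rw [Finset.prod_mul_distrib, EU, EV, mul_one] at fin
  exact fin

lemma sg_s1 (k : ℕ) : ∑ r ∈ Finset.range (k+1), (r : ℂ) = k * (k+1) / 2 := by
  induction k with
  | zero => simp
  | succ n ih => rw [Finset.sum_range_succ, ih]; push_cast; ring

lemma sg_s2 (k : ℕ) : ∑ r ∈ Finset.range (k+1), (r : ℂ) ^ 2 = k * (k+1) * (2 * k + 1) / 6 := by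
  induction k with
  | zero => simp
  | succ n ih => rw [Finset.sum_range_succ, ih]; push_cast; ring

lemma sg_pref (k : ℕ) (τ : ℂ) :
    ∏ a ∈ (Finset.range (k+1) ×ˢ Finset.range (k+1)).erase (0, 0),
      (-Complex.exp (2 * Real.pi * I *
        (((((a.1 : ℝ) / ((k + 1 : ℕ) : ℝ) : ℝ) : ℂ) ^ 2
          - (((a.1 : ℝ) / ((k + 1 : ℕ) : ℝ) : ℝ) : ℂ) + 1 / 6) / 2) * τ)
      * Complex.exp (Real.pi * I * (((a.2 : ℝ) / ((k + 1 : ℕ) : ℝ) : ℝ) : ℂ) *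
        ((((a.1 : ℝ) / ((k + 1 : ℕ) : ℝ) : ℝ) : ℂ) - 1))) ^ (12 * (k+1)) = 1 := by
  have hk : (k : ℂ) + 1 ≠ 0 := by exact_mod_cast Nat.succ_ne_zero k
  set g : ℕ × ℕ → ℂ := fun a => (12 * ((k : ℂ)+1)) * (Real.pi * I * τ *
      (((a.1 : ℂ)^2 / (k+1)^2 - a.1 / (k+1)) + 1/6)
      + Real.pi * I * (a.2 * (a.1 - (k+1)) / (k+1)^2)) with hg
  have h1 : ∀ a ∈ (Finset.range (k+1) ×ˢ Finset.range (k+1)).erase (0, 0),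
      (-Complex.exp (2 * Real.pi * I *
        (((((a.1 : ℝ) / ((k + 1 : ℕ) : ℝ) : ℝ) : ℂ) ^ 2
          - (((a.1 : ℝ) / ((k + 1 : ℕ) : ℝ) : ℝ) : ℂ) + 1 / 6) / 2) * τ)
      * Complex.exp (Real.pi * I * (((a.2 : ℝ) / ((k + 1 : ℕ) : ℝ) : ℝ) : ℂ) *
        ((((a.1 : ℝ) / ((k + 1 : ℕ) : ℝ) : ℝ) : ℂ) - 1))) ^ (12 * (k+1)) = Complex.exp (g a) := by
    intro a _
    have ev : Even (12 * (k+1)) := ⟨6 * (k+1), by ring⟩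
    rw [neg_mul, ev.neg_pow, ← Complex.exp_add, ← Complex.exp_nat_mul]
    congr 1
    simp only [hg]
    push_cast
    field_simp
  rw [Finset.prod_congr rfl h1, ← Complex.exp_sum]
  have h2 := Finset.add_sum_erase (Finset.range (k+1) ×ˢ Finset.range (k+1)) g
    (a := (0,0)) (by simp)
  have h3 : ∑ a ∈ Finset.range (k+1) ×ˢ Finset.range (k+1), g a =
      (12 * ((k : ℂ)+1)) * (Real.pi * I * τ * (1/6)
        - Real.pi * I * (k * (k+2) / 4)) := by
    rw [Finset.sum_product]
    simp only [hg, ← Finset.mul_sum, Finset.sum_add_distrib, ← Finset.sum_div,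
      ← Finset.sum_mul, Finset.sum_sub_distrib, Finset.sum_const, Finset.card_range,
      nsmul_eq_mul, sg_s1, sg_s2]
    push_cast
    field_simp
    ring
  have h4 : g (0,0) = (12 * ((k : ℂ)+1)) * (Real.pi * I * τ * (1/6)) := by
    simp [hg]
  obtain ⟨m, hm⟩ : ∃ m : ℕ, k * (k+1) = m + m := Nat.even_mul_succ_self k
  have hm' : (k : ℂ) * (k+1) = m + m := by exact_mod_cast hm
  rw [Complex.exp_eq_one_iff]
  refine ⟨-(3 * (m * (k+2))), ?_⟩
  rw [h3, h4] at h2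
  push_cast
  linear_combination h2 - 3 * Real.pi * I * (k+2) * hm'

theorem prod_siegel_pow_eq (p : ℕ) (hp : p.Prime) (τ : ℂ) (hτ : 0 < τ.im) :
    ∏ a ∈ (Finset.range p ×ˢ Finset.range p).erase (0, 0),
      (siegelFunction ((a.1 : ℝ) / p) ((a.2 : ℝ) / p) τ) ^ (12 * p)
      = (p : ℂ) ^ (12 * p) := by
  obtain ⟨k, rfl⟩ : ∃ k, p = k + 1 := ⟨p - 1, by have := hp.pos; omega⟩
  have hk : (k : ℂ) + 1 ≠ 0 := by exact_mod_cast Nat.succ_ne_zero k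
  set x := Complex.exp (2 * Real.pi * I * (τ / ((k+1 : ℕ) : ℂ))) with hxd
  set z := Complex.exp (2 * Real.pi * I / ((k+1 : ℕ) : ℂ)) with hzd
  have hz : IsPrimitiveRoot z (k+1) := Complex.isPrimitiveRoot_exp (k+1) (Nat.succ_ne_zero k)
  have hx : ‖x‖ < 1 := by
    have hpos : 0 < (τ / ((k+1 : ℕ) : ℂ)).im := by
      rw [Complex.div_natCast_im]; positivity
    exact UpperHalfPlane.norm_exp_two_pi_I_lt_one ⟨_, hpos⟩
  simp only [siegelFunction, mul_pow _ (tprod _)]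
  rw [Finset.prod_mul_distrib, sg_pref k τ, one_mul, Finset.prod_pow]
  congr 1
  push_cast
  refine Eq.trans ?_ (sg_core k x z hx hz)
  refine Finset.prod_congr rfl fun a ha => ?_
  have ha1 : a.1 < k + 1 := by
    have := Finset.mem_of_mem_erase ha
    simp only [Finset.mem_product, Finset.mem_range] at this
    exact this.1
  refine tprod_congr fun n => ?_
  congr 2
  · congr 1
    · rw [hxd, ← Complex.exp_nat_mul]
      congr 1; push_cast; field_simp
    · rw [hzd, ← Complex.exp_nat_mul]
      congr 1; push_cast; field_simp
  · congr 1
    · rw [hxd, ← Complex.exp_nat_mul]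
      congr 1; push_cast [Nat.cast_sub ha1.le]; field_simp; ring
    · rw [hzd, ← Complex.exp_neg, ← Complex.exp_nat_mul]
      congr 1; push_cast; field_simp
end

section
/- Let $p$ be an odd prime and let $a, k$ be integers with $1 \le a \le p-1$ and $2 \le k \le (p-1)/2$. Then $\frac{2}{p} < \left| \frac{\sin(\pi a k / p)}{\sin(\pi a / p)} \right| < \frac{p}{2}$. -/
open Real

lemma aux_half (p r : ℕ) (hr : 1 ≤ r) (h : 2 * r < p) :
    2 / (p : ℝ) < Real.sin (π * r / p) := by
  have hp : (0 : ℝ) < p := by exact_mod_cast (by omega : 0 < p)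
  have hr' : (1 : ℝ) ≤ r := by exact_mod_cast hr
  have h' : 2 * (r : ℝ) < p := by exact_mod_cast h
  have h1 : 0 < π * r / p := by positivity
  have h2 : π * r / p < π / 2 := by
    rw [div_lt_div_iff₀ hp two_pos]
    nlinarith [Real.pi_pos]
  have h3 := Real.mul_lt_sin h1 h2
  have h4 : 2 / π * (π * r / p) = 2 * r / p := by
    field_simp
  rw [h4] at h3
  refine lt_of_le_of_lt ?_ h3
  gcongr
  linarith

lemma aux_all (p n : ℕ) (hodd : Odd p) (hn : ¬ p ∣ n) :
    2 / (p : ℝ) < |Real.sin (π * n / p)| := by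
  have hp0 : 0 < p := hodd.pos
  have hp : (p : ℝ) ≠ 0 := by exact_mod_cast hp0.ne'
  have hr0 : n % p ≠ 0 := fun h => hn (Nat.dvd_of_mod_eq_zero h)
  have hrp : n % p < p := Nat.mod_lt _ hp0
  have hdm : ((n % p : ℕ) : ℝ) + p * (n / p : ℕ) = n := by
    exact_mod_cast Nat.mod_add_div n p
  have hx : π * n / p = π * (n % p : ℕ) / p + (n / p : ℕ) * π := by
    rw [← hdm]; field_simp
  rw [hx, Real.sin_add_nat_mul_pi, abs_mul, abs_pow, abs_neg, abs_one, one_pow, one_mul]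
  refine lt_of_lt_of_le ?_ (le_abs_self _)
  generalize n % p = r at *
  obtain ⟨m, hm⟩ := hodd
  by_cases h : 2 * r < p
  · exact aux_half p r (by omega) h
  · have := aux_half p (p - r) (by omega) (by omega)
    rw [Nat.cast_sub hrp.le] at this
    have e : π * ((p : ℝ) - r) / p = π - π * r / p := by field_simp
    rwa [e, Real.sin_pi_sub] at this

/-- For an odd prime `p` and integers `1 ≤ a ≤ p - 1`, `2 ≤ k ≤ (p-1)/2`,
`2/p < |sin(πak/p)/sin(πa/p)| < p/2`. -/
theorem cyclotomic_unit_conjugate_bounds (p a k : ℕ) (hp : p.Prime) (hodd : Odd p)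
    (ha : 1 ≤ a) (ha' : a ≤ p - 1) (hk : 2 ≤ k) (hk' : k ≤ (p - 1) / 2) :
    2 / (p : ℝ) < |Real.sin (π * a * k / p) / Real.sin (π * a / p)| ∧
    |Real.sin (π * a * k / p) / Real.sin (π * a / p)| < (p : ℝ) / 2 := by
  have hp0 : (0 : ℝ) < p := by exact_mod_cast hp.pos
  have hpp := hp.pos
  have hna : ¬ p ∣ a := Nat.not_dvd_of_pos_of_lt (by omega) (by omega)
  have hnk : ¬ p ∣ k := Nat.not_dvd_of_pos_of_lt (by omega) (by omega)
  have hnak : ¬ p ∣ a * k := fun h => (hp.dvd_mul.mp h).elim hna hnk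
  have h1 := aux_all p a hodd hna
  have h2 := aux_all p (a * k) hodd hnak
  rw [Nat.cast_mul, ← mul_assoc] at h2
  have b1 := Real.abs_sin_le_one (π * a / p)
  have b2 := Real.abs_sin_le_one (π * a * k / p)
  have h0 : 0 < 2 / (p : ℝ) := by positivity
  have hs : 0 < |Real.sin (π * a / p)| := h0.trans h1
  rw [abs_div]
  constructor
  · rw [lt_div_iff₀ hs]
    nlinarith
  · rw [div_lt_iff₀ hs]
    have : (p : ℝ) / 2 * (2 / p) = 1 := by field_simp
    have h5 : (p : ℝ) / 2 * (2 / p) < p / 2 * |Real.sin (π * a / p)| := by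
      gcongr
    linarith
end

section
/- Let $p \ge 7$ be a prime and let $h^+$ denote the class number of the maximal real subfield $\mathbb{Q}(\zeta_p)^+ = \mathbb{Q}(\zeta_p + \zeta_p^{-1})$ of the $p$-th cyclotomic field, where $\zeta_p = e^{2\pi i/p}$. Then $h^+ < p^{(p-3)/4} (\log p)^{(p-3)/2}$. -/
open Complex IntermediateField


lemma rc_bern (k : ℕ) (b d : ℝ) (hb : 0 ≤ b) (hd : 0 ≤ d) :
    b ^ (k+1) + (k+1) * b ^ k * d ≤ (b + d) ^ (k+1) := by
  induction k with
  | zero => simp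
  | succ k ih =>
    have h1 := mul_le_mul_of_nonneg_right ih (add_nonneg hb hd)
    have h2 : 0 ≤ ((k:ℝ)+1) * b ^ k * d * d := by positivity
    rw [pow_succ (b+d)]
    refine le_trans ?_ h1
    push_cast
    ring_nf at h2 ⊢
    nlinarith [h2]

lemma rc_sum (k : ℕ) (x : ℝ) (M : ℕ) (hM : 1 ≤ M) (hMx : (M:ℝ) ≤ x) :
    ∑ m ∈ Finset.Icc 1 M, (1 / (m:ℝ)) * (Real.log (x / m) + k) ^ k ≤
      (Real.log x + k) ^ k + ((Real.log x + k) ^ (k+1) - (Real.log (x / M) + k) ^ (k+1)) / (k+1) := by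
  induction M, hM using Nat.le_induction with
  | base => simp
  | succ M hM ih =>
    rw [Finset.sum_Icc_succ_top (by omega)]
    have hM0 : (0:ℝ) < M := by exact_mod_cast hM
    push_cast at hMx
    have h1 := ih (by linarith)
    have hx : 0 < x := by linarith
    push_cast
    set b := Real.log (x / (M+1)) + k with hb
    have hb0 : 0 ≤ b := by
      have : 0 ≤ Real.log (x / (M+1)) := Real.log_nonneg (by rw [le_div_iff₀ (by positivity)]; linarith)
      positivity
    have hd : 1 / ((M:ℝ)+1) ≤ Real.log (x / M) + k - b := by
      have := Real.one_sub_inv_le_log_of_pos (x := ((M:ℝ)+1)/M) (by positivity)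
      have e : (1:ℝ) - (((M:ℝ)+1)/M)⁻¹ = 1 / (M+1) := by field_simp; ring
      rw [e, Real.log_div (by positivity) (by positivity)] at this
      rw [hb, Real.log_div (by positivity) (by positivity), Real.log_div (by positivity) (by positivity)]
      linarith
    have h2 := rc_bern k b (Real.log (x / M) + k - b) hb0 (le_trans (by positivity) hd)
    have h3 : 1 / ((M:ℝ)+1) * b ^ k ≤ ((Real.log (x / M) + k)^(k+1) - b^(k+1)) / (k+1) := by
      rw [le_div_iff₀ (by positivity)]
      have h4 := mul_le_mul_of_nonneg_left hd (show 0 ≤ ((k:ℝ)+1) * b^k by positivity)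
      rw [add_sub_cancel] at h2
      linarith
    calc _ ≤ _ := add_le_add h1 h3
      _ = _ := by ring

lemma rc_tuples (k : ℕ) : ∀ (x : ℝ), 1 ≤ x → ∀ S : Finset (Fin (k+1) → ℕ),
    (∀ m ∈ S, (∀ i, 1 ≤ m i) ∧ ((∏ i, m i : ℕ) : ℝ) ≤ x) →
    (S.card : ℝ) ≤ x * (Real.log x + k) ^ k / k.factorial := by
  induction k with
  | zero =>
    intro x hx S hS
    have : S.card ≤ (Finset.Icc 1 ⌊x⌋₊).card := by
      apply Finset.card_le_card_of_injOn (fun m => m 0)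
      · intro m hm
        have := hS m hm
        simp only [Finset.coe_Icc, Set.mem_Icc]
        refine ⟨this.1 0, Nat.le_floor ?_⟩
        simpa using this.2
      · intro a _ b _ h
        ext i
        fin_cases i
        exact h
    simp at this
    simp
    exact le_trans (by exact_mod_cast this) (Nat.floor_le (by linarith))
  | succ k ih =>
    intro x hx S hS
    have hpos : ∀ m ∈ S, 1 ≤ ∏ i : Fin (k+1), m i.succ := fun m hm =>
      Nat.one_le_iff_ne_zero.mpr (Finset.prod_ne_zero_iff.mpr fun i _ =>
        Nat.one_le_iff_ne_zero.mp ((hS m hm).1 (Fin.succ i)))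
    have hmaps : ∀ m ∈ S, m 0 ∈ Finset.Icc 1 ⌊x⌋₊ := by
      intro m hm
      have h := hS m hm
      rw [Finset.mem_Icc]
      refine ⟨h.1 0, Nat.le_floor (le_trans ?_ h.2)⟩
      rw [Fin.prod_univ_succ]
      exact_mod_cast Nat.le_mul_of_pos_right _ (hpos m hm)
    have hM1 : 1 ≤ ⌊x⌋₊ := Nat.le_floor (by simpa using hx)
    have hMx : ((⌊x⌋₊ : ℕ) : ℝ) ≤ x := Nat.floor_le (by linarith)
    have hfib : ∀ a ∈ Finset.Icc 1 ⌊x⌋₊, ((S.filter (fun m => m 0 = a)).card : ℝ) ≤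
        x * (1 / (a:ℝ) * (Real.log (x / a) + k) ^ k) / k.factorial := by
      intro a ha
      rw [Finset.mem_Icc] at ha
      have ha0 : (0:ℝ) < a := by exact_mod_cast ha.1
      have hax : (a:ℝ) ≤ x := le_trans (by exact_mod_cast ha.2) hMx
      have hc : (S.filter (fun m => m 0 = a)).card =
          ((S.filter (fun m => m 0 = a)).image (fun m => Fin.tail m)).card := by
        rw [Finset.card_image_of_injOn]
        intro m hm m' hm' h
        simp only [Finset.coe_filter, Set.mem_ofPred_eq] at hm hm'
        rw [← Fin.cons_self_tail m, ← Fin.cons_self_tail m', hm.2, hm'.2]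
        simp only at h
        rw [h]
      rw [hc]
      have := ih (x / a) (by rw [le_div_iff₀ ha0]; linarith)
        ((S.filter (fun m => m 0 = a)).image (fun m => Fin.tail m)) (by
          intro m' hm'
          rw [Finset.mem_image] at hm'
          obtain ⟨m, hm, rfl⟩ := hm'
          rw [Finset.mem_filter] at hm
          obtain ⟨h1, h2⟩ := hS m hm.1
          refine ⟨fun i => h1 i.succ, ?_⟩
          rw [le_div_iff₀ ha0]
          rw [Fin.prod_univ_succ, hm.2] at h2
          push_cast at h2 ⊢
          simp only [Fin.tail]
          linarith)
      calc _ ≤ _ := this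
        _ = _ := by ring
    rw [Finset.card_eq_sum_card_fiberwise (f := fun m : Fin (k+1+1) → ℕ => m 0) (s := S)
      (t := Finset.Icc 1 ⌊x⌋₊) (fun m hm => hmaps m hm)]
    push_cast
    refine (Finset.sum_le_sum hfib).trans ?_
    rw [← Finset.sum_div, ← Finset.mul_sum]
    have h1 := rc_sum k x ⌊x⌋₊ hM1 hMx
    have hL : 0 ≤ Real.log x := Real.log_nonneg hx
    have h2 := rc_bern k (Real.log x + k) 1 (by positivity) zero_le_one
    have h3 : 0 ≤ (Real.log (x / ⌊x⌋₊) + k) ^ (k+1) := by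
      have : 0 ≤ Real.log (x / ⌊x⌋₊) := Real.log_nonneg (by
        rw [le_div_iff₀ (by exact_mod_cast hM1)]; linarith)
      positivity
    rw [Nat.factorial_succ]
    push_cast
    rw [div_le_div_iff₀ (by positivity) (by positivity)]
    have h4 : (∑ m ∈ Finset.Icc 1 ⌊x⌋₊, (1 / (m:ℝ)) * (Real.log (x / m) + k) ^ k) * (k+1) ≤
        (Real.log x + (k+1)) ^ (k+1) := by
      rw [← le_div_iff₀ (by positivity)]
      refine h1.trans ?_
      rw [le_div_iff₀ (by positivity), add_mul, div_mul_cancel₀ _ (by positivity), ← add_assoc]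
      linarith
    have h5 := mul_le_mul_of_nonneg_left h4 (show 0 ≤ x * k.factorial by positivity)
    linarith

lemma rc_multiset {ι : Type*} [DecidableEq ι] {n : ℕ} (Pr : ι → Prop) (N q f : ι → ℕ)
    (e : ι → Fin n)
    (hq : ∀ i, Pr i → (q i).Prime) (hf : ∀ i, Pr i → 0 < f i) (hN : ∀ i, Pr i → N i = q i ^ f i)
    (hinj : ∀ i j, Pr i → Pr j → q i = q j → e i = e j → i = j) (s t : Multiset ι)
    (hs : ∀ i ∈ s, Pr i) (ht : ∀ i ∈ t, Pr i)
    (h : ∀ a : Fin n, ((s.filter (fun i => e i = a)).map N).prod =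
      ((t.filter (fun i => e i = a)).map N).prod) : s = t := by
  have hpos : ∀ i, Pr i → N i ≠ 0 := by
    intro i hi
    rw [hN i hi]
    exact (pow_pos (hq i hi).pos _).ne'
  have key : ∀ (a : ι) (_ : Pr a) (s : Multiset ι), (∀ i ∈ s, Pr i) →
      (((s.filter (fun i => e i = e a)).map N).prod).factorization (q a) = s.count a * f a := by
    intro a ha s
    induction s using Multiset.induction with
    | empty => simp
    | cons b s ih =>
      intro hs
      have hb' : Pr b := hs b (Multiset.mem_cons_self b s)
      have hs' : ∀ i ∈ s, Pr i := fun i hi => hs i (Multiset.mem_cons_of_mem hi)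
      have ih := ih hs'
      have hne : ((s.filter (fun i => e i = e a)).map N).prod ≠ 0 := by
        apply Multiset.prod_ne_zero
        rw [Multiset.mem_map]
        rintro ⟨i, hi, h0⟩
        exact hpos i (hs' i (Multiset.mem_of_mem_filter hi)) h0
      by_cases hb : e b = e a
      · rw [Multiset.filter_cons_of_pos (p := fun i => e i = e a) _ hb, Multiset.map_cons,
          Multiset.prod_cons, Nat.factorization_mul (hpos b hb') hne,
          Finsupp.add_apply, ih, hN b hb', Nat.factorization_pow]
        by_cases hab : b = a
        · subst hab
          simp [(hq b hb').factorization_self]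
          ring
        · have : q b ≠ q a := fun h => hab (hinj _ _ hb' ha h hb)
          rw [Multiset.count_cons_of_ne (Ne.symm hab)]
          simp [(hq b hb').factorization, this]
      · rw [Multiset.filter_cons_of_neg (p := fun i => e i = e a) _ hb, ih,
          Multiset.count_cons_of_ne]
        rintro rfl
        exact hb rfl
  ext a
  by_cases ha : Pr a
  · have := key a ha s hs
    rw [h, key a ha t ht] at this
    exact (Nat.eq_of_mul_eq_mul_right (hf a ha) this).symm
  · rw [Multiset.count_eq_zero_of_notMem (fun h => ha (hs a h)),
      Multiset.count_eq_zero_of_notMem (fun h => ha (ht a h))]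

open NumberField Ideal UniqueFactorizationMonoid in
lemma rc_ideals (K : Type*) [Field K] [NumberField K] (n : ℕ) (hn : Module.finrank ℚ K = n) :
    ∃ φ : Ideal (𝓞 K) → Fin n → ℕ, (∀ I, I ≠ ⊥ → ∏ i, φ I i = absNorm I) ∧
      (∀ I J, I ≠ ⊥ → J ≠ ⊥ → φ I = φ J → I = J) := by
  classical
  have hnpos : 0 < n := hn ▸ Module.finrank_pos
  have : Nonempty (Fin n) := ⟨⟨0, hnpos⟩⟩
  have hlab : ∀ q : ℕ, q.Prime → ∃ g : Ideal (𝓞 K) → Fin n,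
      Set.InjOn g (primesOver (span {(q:ℤ)}) (𝓞 K)) := by
    intro q hq
    have hq0 : span {(q:ℤ)} ≠ ⊥ := by simpa using hq.ne_zero
    have : (span {(q:ℤ)}).IsMaximal :=
      @Int.ideal_span_isMaximal_of_prime q ⟨hq⟩
    have hc := card_primesOverFinset_le_finrank (𝓞 K) ℚ K hq0
    rw [hn] at hc
    let S := IsDedekindDomain.primesOverFinset (span {(q:ℤ)}) (𝓞 K)
    have : Nonempty (S ↪ Fin n) := Function.Embedding.nonempty_of_card_le (by
      rw [Fintype.card_coe, Fintype.card_fin]; exact hc)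
    obtain ⟨g⟩ := this
    refine ⟨fun P => if h : P ∈ S then g ⟨P, h⟩ else Classical.arbitrary _, ?_⟩
    rw [← IsDedekindDomain.coe_primesOverFinset hq0]
    intro P hP Q hQ h
    have hP : P ∈ S := hP
    have hQ : Q ∈ S := hQ
    simp only [hP, hQ, dif_pos] at h
    exact congrArg Subtype.val (g.injective h)
  choose! g hg using hlab
  let q : Ideal (𝓞 K) → ℕ := fun P => absNorm (under ℤ P)
  let f : Ideal (𝓞 K) → ℕ := fun P => (span {(q P : ℤ)}).inertiaDeg' P
  let e : Ideal (𝓞 K) → Fin n := fun P => g (q P) P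
  let Pr : Ideal (𝓞 K) → Prop := fun P => P.IsPrime ∧ P ≠ ⊥
  have hq : ∀ P, Pr P → (q P).Prime := by
    rintro P ⟨h1, h2⟩
    have : NeZero P := ⟨h2⟩
    exact Nat.absNorm_under_prime P
  have hfac : ∀ I : Ideal (𝓞 K), ∀ P ∈ normalizedFactors I, Pr P := by
    intro I P hP
    have := prime_of_normalized_factor P hP
    exact ⟨isPrime_of_prime this, this.ne_zero⟩
  refine ⟨fun I a => (((normalizedFactors I).filter (fun P => e P = a)).map absNorm).prod, ?_, ?_⟩
  · intro I hI
    have h1 : absNorm I = ((normalizedFactors I).map absNorm).prod := by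
      conv_lhs => rw [← Ideal.prod_normalizedFactors_eq_self hI]
      rw [map_multiset_prod]
    rw [h1]
    beta_reduce
    generalize normalizedFactors I = s
    induction s using Multiset.induction with
    | empty => simp
    | cons b s ih =>
      rw [Multiset.map_cons, Multiset.prod_cons, ← ih]
      have : ∀ a, (((b ::ₘ s).filter (fun P => e P = a)).map absNorm).prod =
          (if e b = a then absNorm b else 1) * ((s.filter (fun P => e P = a)).map absNorm).prod := by
        intro a
        by_cases h : e b = a
        · rw [Multiset.filter_cons_of_pos (p := fun P => e P = a) _ h]
          simp [h]
        · rw [Multiset.filter_cons_of_neg (p := fun P => e P = a) _ h]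
          simp [h]
      simp_rw [this]
      rw [Finset.prod_mul_distrib]
      simp
  · intro I J hI hJ h
    have := rc_multiset Pr absNorm q f e hq ?_ ?_ ?_ (normalizedFactors I) (normalizedFactors J)
      (hfac I) (hfac J) (fun a => congrFun h a)
    · rw [← Ideal.prod_normalizedFactors_eq_self hI, this, Ideal.prod_normalizedFactors_eq_self hJ]
    · intro P hP
      have : (span {(q P:ℤ)}).IsMaximal :=
        @Int.ideal_span_isMaximal_of_prime (q P) ⟨hq P hP⟩
      exact inertiaDeg'_pos _ _
    · intro P hP
      exact absNorm_eq_pow_inertiaDeg' P (hq P hP)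
    · intro P Q hP hQ h1 h2
      refine hg (q P) (hq P hP) ⟨hP.1, Int.liesOver_span_absNorm P⟩ ?_ ?_
      · rw [h1]
        exact ⟨hQ.1, Int.liesOver_span_absNorm Q⟩
      · simp only [e] at h2
        rw [h2, h1]

open NumberField Ideal nonZeroDivisors in
lemma rc_classno (K : Type*) [Field K] [NumberField K] (k : ℕ)
    (hn : Module.finrank ℚ K = k+1) (x : ℝ)
    (hx : ∀ C : ClassGroup (𝓞 K), ∃ I : (Ideal (𝓞 K))⁰, ClassGroup.mk0 I = C ∧
      (absNorm (I : Ideal (𝓞 K)) : ℝ) ≤ x) :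
    1 ≤ x ∧ (Nat.card (ClassGroup (𝓞 K)) : ℝ) ≤ x * (Real.log x + k) ^ k / k.factorial := by
  classical
  obtain ⟨φ, h1, h2⟩ := rc_ideals K (k+1) hn
  choose I hI hIx using hx
  have hne : ∀ C, (I C : Ideal (𝓞 K)) ≠ ⊥ := fun C => nonZeroDivisors.coe_ne_zero (I C)
  have hpos : ∀ C, 1 ≤ absNorm (I C : Ideal (𝓞 K)) := fun C =>
    Nat.one_le_iff_ne_zero.mpr (absNorm_ne_zero_of_nonZeroDivisors (I C))
  have hx1 : 1 ≤ x := le_trans (by exact_mod_cast hpos 1) (hIx 1)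
  refine ⟨hx1, ?_⟩
  have hinj : Function.Injective (fun C => φ (I C : Ideal (𝓞 K))) := by
    intro C D h
    have := Subtype.ext (h2 _ _ (hne C) (hne D) h)
    rw [← hI C, ← hI D, this]
  have := rc_tuples k x hx1 (Finset.univ.image (fun C => φ (I C : Ideal (𝓞 K)))) (by
    intro m hm
    rw [Finset.mem_image] at hm
    obtain ⟨C, -, rfl⟩ := hm
    rw [h1 _ (hne C)]
    refine ⟨fun i => ?_, hIx C⟩
    have h3 := hpos C
    rw [← h1 _ (hne C)] at h3
    exact Nat.one_le_iff_ne_zero.mpr (Finset.prod_ne_zero_iff.mp (Nat.one_le_iff_ne_zero.mp h3) i (Finset.mem_univ i)))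
  rw [Finset.card_image_of_injective _ hinj] at this
  rwa [Nat.card_eq_fintype_card]

lemma rc_final (p k : ℕ) (hp7 : 7 ≤ p) (hk : p = 2 * k + 3) (D : ℝ)
    (hD : D ≤ (p:ℝ) ^ k) (h x : ℝ)
    (hx : x = ((k+1).factorial : ℝ) / ((k:ℝ)+1) ^ (k+1) * Real.sqrt D) (hx1 : 1 ≤ x)
    (hh : h ≤ x * (Real.log x + k) ^ k / k.factorial) :
    h < (p : ℝ) ^ (((p : ℝ) - 3) / 4) * (Real.log p) ^ (((p : ℝ) - 3) / 2) := by
  have hpr : (p:ℝ) = 2 * k + 3 := by exact_mod_cast hk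
  have hp0 : (0:ℝ) < p := by positivity
  have hk2 : 2 ≤ k := by omega
  have e2 : (Real.log p) ^ (((p : ℝ) - 3) / 2) = (Real.log p) ^ k := by
    rw [← Real.rpow_natCast]; congr 1; rw [hpr]; ring
  have e1 : (p : ℝ) ^ (((p : ℝ) - 3) / 4) = Real.sqrt ((p:ℝ)^k) := by
    rw [Real.sqrt_eq_rpow, ← Real.rpow_natCast, ← Real.rpow_mul hp0.le]; congr 1; rw [hpr]; ring
  rw [e1, e2]
  have hL0 : 0 < Real.log p := Real.log_pos (by exact_mod_cast (by omega : 1 < p))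
  have hsD : Real.sqrt D ≤ Real.sqrt ((p:ℝ)^k) := Real.sqrt_le_sqrt hD
  have hfac : ((k+1).factorial : ℝ) ≤ ((k:ℝ)+1)^(k+1) := by
    exact_mod_cast Nat.factorial_le_pow (k+1)
  have hxs : x ≤ Real.sqrt ((p:ℝ)^k) := by
    rw [hx]
    calc _ ≤ 1 * Real.sqrt D := by
          gcongr
          rw [div_le_one (by positivity)]; exact hfac
      _ ≤ _ := by rwa [one_mul]
  have hlog : Real.log x ≤ k / 2 * Real.log p := by
    refine (Real.log_le_log (by linarith) hxs).trans ?_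
    rw [Real.log_sqrt (by positivity), Real.log_pow]
    apply le_of_eq; ring
  have hlx0 : 0 ≤ Real.log x := Real.log_nonneg hx1
  have hlt : Real.log x + k < (k+1) * Real.log p := by
    have hlog7 : 1 < Real.log p := by
      rw [Real.lt_log_iff_exp_lt hp0]
      have := Real.exp_one_lt_d9
      have : (7:ℝ) ≤ p := by exact_mod_cast hp7
      linarith
    have hkr : (2:ℝ) ≤ k := by exact_mod_cast hk2
    rcases Nat.lt_or_ge k 3 with h3 | h3
    · have : k = 2 := by omega
      subst this
      push_cast at *
      linarith
    · have hlog9 : 2 < Real.log p := by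
        rw [Real.lt_log_iff_exp_lt hp0]
        have h1 := Real.exp_one_lt_d9
        have h0 := Real.exp_pos 1
        have : (9:ℝ) ≤ p := by exact_mod_cast (by omega : 9 ≤ p)
        have e : Real.exp 2 = Real.exp 1 * Real.exp 1 := by rw [← Real.exp_add]; norm_num
        rw [e]
        nlinarith
      nlinarith
  have hk1 : (0:ℝ) < (k:ℝ) + 1 := by positivity
  have hs0 : 0 < Real.sqrt ((p:ℝ)^k) := by positivity
  refine hh.trans_lt ?_
  have e3 : x * (Real.log x + k) ^ k / k.factorial =
      Real.sqrt D * ((Real.log x + k) / (k+1)) ^ k := by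
    nth_rewrite 1 [hx]
    rw [Nat.factorial_succ]
    push_cast
    rw [div_pow, pow_succ]
    field_simp
  rw [e3]
  have h5 : ((Real.log x + k) / (k+1)) ^ k < (Real.log p) ^ k := by
    apply pow_lt_pow_left₀ _ (by positivity) (by omega)
    rw [div_lt_iff₀ hk1]; linarith
  calc _ ≤ Real.sqrt ((p:ℝ)^k) * ((Real.log x + k) / (k+1)) ^ k := by gcongr
    _ < _ := by gcongr

open NumberField in
lemma rc_discr (K L : Type*) [Field K] [NumberField K] [Field L] [NumberField L] [Algebra K L]
    (p k : ℕ) (hp : p.Prime) (hk : p = 2 * k + 3) [IsCyclotomicExtension {p} ℚ L]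
    (h2 : Module.finrank K L = 2) : (|(discr K : ℝ)|) ≤ (p:ℝ) ^ k := by
  have : Fact p.Prime := ⟨hp⟩
  have h1 := natAbs_discr_eq_absNorm_differentIdeal_mul_natAbs_discr_pow K (𝓞 K) L (𝓞 L)
  rw [IsCyclotomicExtension.Rat.discr_prime p L, h2, Int.natAbs_mul, Int.natAbs_pow, Int.natAbs_pow] at h1
  simp only [Int.natAbs_neg, Int.natAbs_one, one_pow, one_mul, Int.natAbs_natCast] at h1
  have hdvd : (discr K).natAbs ^ 2 ∣ p ^ (p - 2) := ⟨_, by rw [h1, mul_comm]⟩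
  obtain ⟨e, -, he⟩ := (Nat.dvd_prime_pow hp).mp (dvd_trans (dvd_pow_self _ two_ne_zero) hdvd)
  rw [he, ← pow_mul] at hdvd
  have h3 := (Nat.pow_dvd_pow_iff_le_right hp.one_lt).mp hdvd
  have h4 : (discr K).natAbs ≤ p ^ k := by
    rw [he]
    exact Nat.pow_le_pow_right hp.pos (by omega)
  rw [← Int.cast_abs, Int.abs_eq_natAbs]
  exact_mod_cast h4

open NumberField in
lemma rc_field (p : ℕ) (hp : p.Prime) (hp7 : 7 ≤ p) (ζ : ℂ) (hζ : IsPrimitiveRoot ζ p)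
    (K : IntermediateField ℚ ℂ) (hK : K = ℚ⟮ζ + ζ⁻¹⟯) :
    NumberField K ∧ IsTotallyReal K ∧ ∃ (L : IntermediateField K ℂ), NumberField L ∧
      IsCyclotomicExtension {p} ℚ L ∧ Module.finrank K L = 2 := by
  have : NeZero p := ⟨hp.ne_zero⟩
  have hζ0 : ζ ≠ 0 := hζ.ne_zero hp.ne_zero
  have hint : IsIntegral ℚ ζ := (hζ.isIntegral hp.pos).tower_top
  have hnorm : ∀ w : ℂ, w ^ p = 1 → (starRingEnd ℂ) w = w⁻¹ := by
    intro w hw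
    rw [Complex.inv_def, Complex.normSq_eq_norm_sq, Complex.norm_eq_one_of_pow_eq_one hw hp.ne_zero]
    simp
  have hconj := hnorm ζ hζ.pow_eq_one
  have hfin : FiniteDimensional ℚ K := by
    rw [hK]
    exact adjoin.finiteDimensional (hint.add ((hζ.inv.isIntegral hp.pos).tower_top))
  have hNK : NumberField K := { to_charZero := inferInstance, to_finiteDimensional := hfin }
  have haK : ζ + ζ⁻¹ ∈ K := by
    rw [hK]; exact mem_adjoin_simple_self ℚ _
  have hintK : IsIntegral K ζ := hint.tower_top
  have hnot : ζ ∉ (algebraMap K ℂ).range := by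
    rintro ⟨⟨z, hz⟩, rfl⟩
    have hle : K ≤ (IsScalarTower.toAlgHom ℚ ℝ ℂ).fieldRange := by
      rw [hK, adjoin_simple_le_iff]
      rw [← hconj, Complex.add_conj]
      exact ⟨_, rfl⟩
    obtain ⟨r, hr⟩ := hle hz
    have hr' : (r : ℂ) = z := hr
    change (starRingEnd ℂ) z = z⁻¹ at hconj
    rw [← hr', Complex.conj_ofReal] at hconj
    have h0 : (r:ℂ) ≠ 0 := by rw [hr']; exact hζ0
    have h2 : z ^ 2 = 1 := by
      rw [← hr', pow_two]
      nth_rewrite 2 [hconj]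
      exact mul_inv_cancel₀ h0
    have := Nat.le_of_dvd two_pos (hζ.dvd_of_pow_eq_one 2 h2)
    omega
  have hdeg : (minpoly K ζ).natDegree = 2 := by
    apply le_antisymm _ ((minpoly.two_le_natDegree_iff hintK).mpr hnot)
    let a : K := ⟨ζ + ζ⁻¹, haK⟩
    let P : Polynomial K := Polynomial.C 1 * Polynomial.X ^ 2 + Polynomial.C (-a) * Polynomial.X + Polynomial.C 1
    have hP : P.natDegree = 2 := Polynomial.natDegree_quadratic one_ne_zero
    rw [← hP]
    apply Polynomial.natDegree_le_of_dvd
    · apply minpoly.dvd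
      have ha : algebraMap K ℂ a = ζ + ζ⁻¹ := rfl
      simp only [P, map_add, map_mul, map_pow, Polynomial.aeval_C, Polynomial.aeval_X, map_neg, map_one, ha]
      field_simp
      ring
    · intro h0
      rw [h0] at hP
      simp at hP
  have hres : (K⟮ζ⟯).restrictScalars ℚ = ℚ⟮ζ⟯ := by
    apply le_antisymm
    · have hle : K ≤ ℚ⟮ζ⟯ := by
        rw [hK, adjoin_simple_le_iff]
        exact add_mem (mem_adjoin_simple_self ℚ ζ) (inv_mem (mem_adjoin_simple_self ℚ ζ))
      have h2 : K⟮ζ⟯ ≤ extendScalars hle := by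
        rw [adjoin_simple_le_iff]
        exact mem_adjoin_simple_self ℚ ζ
      intro x hx
      exact h2 hx
    · rw [adjoin_simple_le_iff]
      exact mem_adjoin_simple_self K ζ
  have hcyc : IsCyclotomicExtension {p} ℚ K⟮ζ⟯ := by
    have : IsCyclotomicExtension {p} ℚ ((K⟮ζ⟯).restrictScalars ℚ) := by
      exact (IntermediateField.isCyclotomicExtension_singleton_iff_eq_adjoin (n := p) (K := ℚ) (L := ℂ)
        (F := (K⟮ζ⟯).restrictScalars ℚ) (hζ := hζ)).mpr hres
    let e : (K⟮ζ⟯).restrictScalars ℚ ≃+* K⟮ζ⟯ := RingEquiv.refl _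
    exact IsCyclotomicExtension.equiv {p} ℚ _ (AlgEquiv.ofRingEquiv (f := e) (fun x => by simp))
  have hNL : NumberField K⟮ζ⟯ := IsCyclotomicExtension.numberField {p} ℚ _
  refine ⟨hNK, ⟨?_⟩, K⟮ζ⟯, hNL, hcyc, ?_⟩
  · intro v
    rw [← InfinitePlace.mk_embedding v]
    rw [InfinitePlace.isReal_mk_iff]
    generalize v.embedding = φ
    have hz : (AdjoinSimple.gen K ζ) ^ p = 1 := by
      apply Subtype.ext
      push_cast
      rw [AdjoinSimple.coe_gen]
      exact hζ.pow_eq_one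
    let w : ℂ := ComplexEmbedding.lift K⟮ζ⟯ φ (AdjoinSimple.gen K ζ)
    have hw : (starRingEnd ℂ) w = w⁻¹ := hnorm w (by
      simp only [w]
      rw [← map_pow, hz, map_one])
    have hφ : φ ⟨ζ + ζ⁻¹, haK⟩ = w + w⁻¹ := by
      rw [← ComplexEmbedding.lift_algebraMap_apply K⟮ζ⟯ φ]
      simp only [w]
      rw [← map_inv₀, ← map_add]
      congr 1
    have hext : ((starRingEnd ℂ).comp φ).toRatAlgHom = φ.toRatAlgHom := by
      apply algHom_ext_of_eq_adjoin (F := ℚ) (hS := hK)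
      intro x hx
      rw [Set.mem_singleton_iff] at hx
      subst hx
      change (starRingEnd ℂ) (φ ⟨ζ + ζ⁻¹, haK⟩) = φ ⟨ζ + ζ⁻¹, haK⟩
      rw [hφ, map_add, map_inv₀, hw, inv_inv, add_comm]
    apply RingHom.ext
    intro x
    exact DFunLike.congr_fun hext x
  · rw [adjoin.finrank hintK, hdeg]

/-- For a prime `p ≥ 7`, the class number `h⁺` of the maximal real subfield
`ℚ(ζ_p)⁺ = ℚ(ζ_p + ζ_p⁻¹)` of the `p`-th cyclotomic field satisfies
`h⁺ < p^{(p-3)/4} (log p)^{(p-3)/2}`. -/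
theorem class_number_real_cyclotomic_bound (p : ℕ) (hp : p.Prime) (hp7 : 7 ≤ p)
    (ζ : ℂ) (hζ : ζ = Complex.exp (2 * Real.pi * I / p)) :
    (Nat.card (ClassGroup (NumberField.RingOfIntegers ℚ⟮ζ + ζ⁻¹⟯)) : ℝ)
      < (p : ℝ) ^ (((p : ℝ) - 3) / 4) * (Real.log p) ^ (((p : ℝ) - 3) / 2) := by
  have hprim : IsPrimitiveRoot ζ p := hζ ▸ Complex.isPrimitiveRoot_exp p hp.ne_zero
  obtain ⟨k, hk⟩ : ∃ k, p = 2 * k + 3 := by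
    rcases hp.eq_two_or_odd' with h | ⟨m, hm⟩
    · omega
    · exact ⟨m - 1, by omega⟩
  obtain ⟨hNK, hTR, L, hNL, hcyc, h2⟩ := rc_field p hp hp7 ζ hprim _ rfl
  have hD := rc_discr ℚ⟮ζ + ζ⁻¹⟯ L p k hp hk h2
  have : NeZero p := ⟨hp.ne_zero⟩
  have hdegL : Module.finrank ℚ L = p - 1 := by
    rw [IsCyclotomicExtension.finrank (n := p) L (Polynomial.cyclotomic.irreducible_rat hp.pos), Nat.totient_prime hp]
  have hdeg : Module.finrank ℚ ℚ⟮ζ + ζ⁻¹⟯ = k + 1 := by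
    have := Module.finrank_mul_finrank ℚ ℚ⟮ζ + ζ⁻¹⟯ L
    rw [h2, hdegL] at this
    omega
  obtain ⟨hx1, hh⟩ := rc_classno ℚ⟮ζ + ζ⁻¹⟯ k hdeg _ NumberField.exists_ideal_in_class_of_norm_le
  refine rc_final p k hp7 hk _ hD _ _ ?_ hx1 hh
  rw [NumberField.IsTotallyReal.nrComplexPlaces_eq_zero, hdeg]
  push_cast
  ring
end
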